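/- arXiv:0708.0715 — 3 statements merged into one kernel-verified Lean document; each statement's English description precedes it below -/
import Mathlib

section
/- Let U be the square of a standard normal random variable (law Measure.map (fun x => x^2) (gaussianReal 0 1)) and let V be the square of a N(θ,1) random variable (law Measure.map (fun x => x^2) (gaussianReal θ 1)) for an arbitrary real θ. Then for all real numbers 0 ≤ d ≤ y, P(V ≤ d) · P(U ≤ y) ≤ P(U ≤ d) · P(V ≤ y). Equivalently, for every y > 0, the variable U/y conditioned on {U ≤ y} is stochastically smaller than V/y conditioned on {V ≤ y}. -/
open MeasureTheory ProbabilityTheory Real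

/-- The mean of the densities of `N(θ,1)` and `N(-θ,1)` relative to the standard normal density
is `exp (-θ²/2) cosh (θ x)`. -/
lemma gaussianPDFReal_add_neg (θ x : ℝ) :
    gaussianPDFReal θ 1 x + gaussianPDFReal (-θ) 1 x
      = 2 * exp (-θ ^ 2 / 2) * cosh (θ * x) * gaussianPDFReal 0 1 x := by
  have h1 : exp (-(x - θ) ^ 2 / (2 * ((1 : NNReal) : ℝ)))
      = exp (-θ ^ 2 / 2) * exp (θ * x) * exp (-(x - 0) ^ 2 / (2 * ((1 : NNReal) : ℝ))) := by
    rw [← exp_add, ← exp_add]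
    congr 1
    push_cast
    ring
  have h2 : exp (-(x - -θ) ^ 2 / (2 * ((1 : NNReal) : ℝ)))
      = exp (-θ ^ 2 / 2) * exp (-(θ * x)) * exp (-(x - 0) ^ 2 / (2 * ((1 : NNReal) : ℝ))) := by
    rw [← exp_add, ← exp_add]
    congr 1
    push_cast
    ring
  simp only [gaussianPDFReal]
  rw [h1, h2, cosh_eq]
  ring

lemma gaussianPDF_add_neg (θ x : ℝ) :
    gaussianPDF θ 1 x + gaussianPDF (-θ) 1 x
      = ENNReal.ofReal (2 * exp (-θ ^ 2 / 2) * cosh (θ * x)) * gaussianPDF 0 1 x := by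
  have := cosh_pos (θ * x)
  simp only [gaussianPDF]
  rw [← ENNReal.ofReal_add (gaussianPDFReal_nonneg _ _ _) (gaussianPDFReal_nonneg _ _ _),
    gaussianPDFReal_add_neg, ENNReal.ofReal_mul (by positivity)]

lemma two_mul_gaussianReal_of_symm (θ : ℝ) {S : Set ℝ} (hS : MeasurableSet S)
    (hsymm : (fun x => -x) ⁻¹' S = S) :
    2 * gaussianReal θ 1 S = ∫⁻ x in S,
      ENNReal.ofReal (2 * exp (-θ ^ 2 / 2) * cosh (θ * x)) * gaussianPDF 0 1 x := by
  have h : gaussianReal (-θ) 1 S = gaussianReal θ 1 S := by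
    rw [← gaussianReal_map_neg, Measure.map_apply measurable_neg hS, hsymm]
  calc 2 * gaussianReal θ 1 S = gaussianReal θ 1 S + gaussianReal (-θ) 1 S := by rw [h, two_mul]
    _ = _ := by
      rw [gaussianReal_apply _ one_ne_zero, gaussianReal_apply _ one_ne_zero,
        ← lintegral_add_left (measurable_gaussianPDF _ _)]
      simp only [gaussianPDF_add_neg]

lemma two_mul_gaussianReal_le (θ a : ℝ) {S : Set ℝ} (hS : MeasurableSet S)
    (hsymm : (fun x => -x) ⁻¹' S = S) (ha : ∀ x ∈ S, |x| ≤ |a|) :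
    2 * gaussianReal θ 1 S
      ≤ ENNReal.ofReal (2 * exp (-θ ^ 2 / 2) * cosh (θ * a)) * gaussianReal 0 1 S := by
  rw [two_mul_gaussianReal_of_symm θ hS hsymm, gaussianReal_apply _ one_ne_zero,
    ← lintegral_const_mul _ (measurable_gaussianPDF _ _)]
  refine setLIntegral_mono' hS fun x hx => ?_
  gcongr ENNReal.ofReal (_ * ?_) * _
  rw [cosh_le_cosh, abs_mul, abs_mul]
  exact mul_le_mul_of_nonneg_left (ha x hx) (abs_nonneg θ)

lemma le_two_mul_gaussianReal (θ a : ℝ) {S : Set ℝ} (hS : MeasurableSet S)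
    (hsymm : (fun x => -x) ⁻¹' S = S) (ha : ∀ x ∈ S, |a| ≤ |x|) :
    ENNReal.ofReal (2 * exp (-θ ^ 2 / 2) * cosh (θ * a)) * gaussianReal 0 1 S
      ≤ 2 * gaussianReal θ 1 S := by
  rw [two_mul_gaussianReal_of_symm θ hS hsymm, gaussianReal_apply _ one_ne_zero,
    ← lintegral_const_mul _ (measurable_gaussianPDF _ _)]
  refine setLIntegral_mono' hS fun x hx => ?_
  gcongr ENNReal.ofReal (_ * ?_) * _
  rw [cosh_le_cosh, abs_mul, abs_mul]
  exact mul_le_mul_of_nonneg_left (ha x hx) (abs_nonneg θ)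

lemma measure_le_eq_gaussianReal {Ω : Type*} [MeasurableSpace Ω] {P : Measure Ω} {θ : ℝ}
    {V : Ω → ℝ} (hV : Measurable V)
    (hVlaw : P.map V = Measure.map (fun x => x ^ 2) (gaussianReal θ 1)) (t : ℝ) :
    P {ω | V ω ≤ t} = gaussianReal θ 1 {x | x ^ 2 ≤ t} := by
  have h := congrArg (fun μ => μ (Set.Iic t)) hVlaw
  rwa [Measure.map_apply hV measurableSet_Iic,
    Measure.map_apply (by fun_prop) measurableSet_Iic] at h

/-- Lemma 1(i) of the paper, in product form: if `U ~ χ²₁` (square of a standard normal)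
and `V ~ χ²₁(θ²)` (square of a `N(θ,1)` variable), then for `0 ≤ d ≤ y`,
`P(V ≤ d) P(U ≤ y) ≤ P(U ≤ d) P(V ≤ y)`; that is, `U/y` given `{U ≤ y}` is
stochastically smaller than `V/y` given `{V ≤ y}`. -/
theorem stmt_2
    {Ω : Type*} [MeasurableSpace Ω] (P : Measure Ω) [IsProbabilityMeasure P]
    (θ : ℝ) (U V : Ω → ℝ) (hU : Measurable U) (hV : Measurable V)
    (hUlaw : P.map U = Measure.map (fun x => x ^ 2) (gaussianReal 0 1))
    (hVlaw : P.map V = Measure.map (fun x => x ^ 2) (gaussianReal θ 1))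
    (d y : ℝ) (hd : 0 ≤ d) (hdy : d ≤ y) :
    P {ω | V ω ≤ d} * P {ω | U ω ≤ y} ≤ P {ω | U ω ≤ d} * P {ω | V ω ≤ y} := by
  simp only [measure_le_eq_gaussianReal hU hUlaw, measure_le_eq_gaussianReal hV hVlaw]
  set A : Set ℝ := {x | x ^ 2 ≤ d} with hA
  set C : Set ℝ := {x | d < x ^ 2 ∧ x ^ 2 ≤ y} with hC
  have hAm : MeasurableSet A := measurableSet_le (by fun_prop) (by fun_prop)
  have hCm : MeasurableSet C :=
    measurableSet_Ioc.preimage (measurable_id.pow_const 2 : Measurable fun x : ℝ => x ^ 2)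
  have hunion : {x : ℝ | x ^ 2 ≤ y} = A ∪ C := by
    ext x
    simp only [hA, hC, Set.mem_ofPred_eq, Set.mem_union]
    grind
  have hdisj : Disjoint A C := Set.disjoint_left.2 fun x hx hx' => not_lt.2 hx hx'.1
  have hle := two_mul_gaussianReal_le θ (√d) hAm (by simp [hA]) fun x hx => by
    rw [← sq_le_sq, sq_sqrt hd]
    exact hx
  have hge := le_two_mul_gaussianReal θ (√d) hCm (by simp [hC]) fun x hx => by
    rw [← sq_le_sq, sq_sqrt hd]
    exact hx.1.le
  rw [hunion, measure_union hdisj hCm, measure_union hdisj hCm, mul_add, mul_add,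
    mul_comm (gaussianReal θ 1 A) (gaussianReal 0 1 A)]
  gcongr _ + ?_
  set c := ENNReal.ofReal (2 * exp (-θ ^ 2 / 2) * cosh (θ * √d))
  rw [← ENNReal.mul_le_mul_iff_right (two_ne_zero) (ENNReal.ofNat_ne_top (n := 2))]
  calc 2 * (gaussianReal θ 1 A * gaussianReal 0 1 C)
      = 2 * gaussianReal θ 1 A * gaussianReal 0 1 C := by ring
    _ ≤ c * gaussianReal 0 1 A * gaussianReal 0 1 C := by gcongr
    _ = gaussianReal 0 1 A * (c * gaussianReal 0 1 C) := by ring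
    _ ≤ gaussianReal 0 1 A * (2 * gaussianReal θ 1 C) := by gcongr
    _ = 2 * (gaussianReal 0 1 A * gaussianReal θ 1 C) := by ring
end

section
/- For every real θ, the noncentral chi-squared distribution with one degree of freedom and noncentrality parameter θ², Measure.map (fun x => x^2) (gaussianReal θ 1), is absolutely continuous with respect to Lebesgue measure on ℝ with density f_θ(x) = (2πx)^{−1/2} · exp(−(x+θ²)/2) · cosh(θ·√x) for x > 0 and f_θ(x) = 0 for x ≤ 0; i.e. it equals volume.withDensity applied to this function (with values taken in ℝ≥0∞ via ENNReal.ofReal). -/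
open MeasureTheory ProbabilityTheory Real

open scoped ENNReal

lemma lintegral_comp_sqrt_add_comp_neg_sqrt {h : ℝ → ℝ≥0∞} (hh : Measurable h) :
    ∫⁻ x, h x = ∫⁻ x in Set.Ioi 0, ENNReal.ofReal (1 / (2 * √x)) * (h (√x) + h (-√x)) := by
  have hderiv : ∀ x ∈ Set.Ioi (0 : ℝ),
      HasDerivWithinAt (fun x => √x) (1 / (2 * √x)) (Set.Ioi 0) x := fun x hx =>
    (hasDerivAt_sqrt (ne_of_gt hx)).hasDerivWithinAt
  have hinj : Set.InjOn (fun x : ℝ => √x) (Set.Ioi 0) := fun x hx y hy hxy =>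
    (sqrt_inj (le_of_lt hx) (le_of_lt hy)).1 hxy
  have himage : (fun x : ℝ => √x) '' Set.Ioi 0 = Set.Ioi 0 := by
    ext y
    constructor
    · rintro ⟨x, hx, rfl⟩
      exact sqrt_pos.2 hx
    · intro hy
      exact ⟨y ^ 2, Set.mem_Ioi.2 (pow_pos (Set.mem_Ioi.1 hy) 2), sqrt_sq (le_of_lt hy)⟩
  have himage_neg : (fun x : ℝ => -√x) '' Set.Ioi 0 = Set.Iio 0 := by
    rw [← Set.image_image (fun x : ℝ => -x), himage]
    simp
  have hpos := lintegral_image_eq_lintegral_abs_deriv_mul measurableSet_Ioi hderiv hinj h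
  have hneg := lintegral_image_eq_lintegral_abs_deriv_mul (f := fun x => -√x) measurableSet_Ioi
    (fun x hx => (hderiv x hx).neg) (fun x hx y hy hxy => hinj hx hy (neg_injective hxy)) h
  have habs (x : ℝ) : |1 / (2 * √x)| = 1 / (2 * √x) := abs_of_nonneg (by positivity)
  simp only [himage, himage_neg, abs_neg, habs] at hpos hneg
  have hsplit := lintegral_add_compl (μ := volume) h (measurableSet_Ioi (a := (0 : ℝ)))
  rw [Set.compl_Ioi, setLIntegral_congr Iio_ae_eq_Iic.symm, hpos, hneg] at hsplit
  rw [← hsplit, ← lintegral_add_left (by fun_prop)]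
  simp only [mul_add]

lemma map_sq_withDensity {p : ℝ → ℝ≥0∞} (hp : Measurable p) :
    Measure.map (fun x => x ^ 2) (volume.withDensity p) =
      volume.withDensity ((Set.Ioi 0).indicator
        fun x => ENNReal.ofReal (1 / (2 * √x)) * (p (√x) + p (-√x))) := by
  ext s hs
  have hsq : Measurable fun x : ℝ => x ^ 2 := by fun_prop
  rw [Measure.map_apply hsq hs, withDensity_apply _ (hsq hs), withDensity_apply _ hs,
    ← lintegral_indicator (hsq hs),
    lintegral_comp_sqrt_add_comp_neg_sqrt (hp.indicator (hsq hs)),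
    setLIntegral_indicator measurableSet_Ioi, Set.inter_comm,
    ← setLIntegral_indicator hs]
  refine setLIntegral_congr_fun measurableSet_Ioi fun x hx => ?_
  have hx' : √x ^ 2 = x := sq_sqrt (le_of_lt hx)
  by_cases hxs : x ∈ s <;> simp [Set.indicator, hx', hxs]

lemma gaussianPDFReal_sqrt_add_neg_sqrt (θ : ℝ) {x : ℝ} (hx : 0 < x) :
    1 / (2 * √x) * (gaussianPDFReal θ 1 (√x) + gaussianPDFReal θ 1 (-√x)) =
      (2 * π * x) ^ (-(1 : ℝ) / 2) * exp (-(x + θ ^ 2) / 2) * cosh (θ * √x) := by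
  have hsq : √x ^ 2 = x := sq_sqrt hx.le
  have hpos : exp (-(√x - θ) ^ 2 / 2) = exp (-(x + θ ^ 2) / 2) * exp (θ * √x) := by
    rw [← exp_add]
    congr 1
    linear_combination -hsq / 2
  have hneg : exp (-(-√x - θ) ^ 2 / 2) = exp (-(x + θ ^ 2) / 2) * exp (-(θ * √x)) := by
    rw [← exp_add]
    congr 1
    linear_combination -hsq / 2
  have hrpow : (2 * π * x) ^ (-(1 : ℝ) / 2) = (√(2 * π))⁻¹ * (√x)⁻¹ := by
    rw [neg_div, rpow_neg (by positivity), ← sqrt_eq_rpow, sqrt_mul (by positivity), mul_inv]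
  simp only [gaussianPDFReal, NNReal.coe_one, mul_one]
  rw [hpos, hneg, hrpow, cosh_eq, one_div, mul_inv]
  ring

/-- The noncentral χ² distribution with one degree of freedom and noncentrality
parameter `θ²`, i.e. the law of the square of a `N(θ,1)` variable, has density
`f_θ(x) = (2πx)^{−1/2} exp(−(x+θ²)/2) cosh(θ√x)` for `x > 0` (and `0` for `x ≤ 0`)
with respect to Lebesgue measure. -/
theorem stmt_12 (θ : ℝ) :
    Measure.map (fun x => x ^ 2) (gaussianReal θ 1) =
    volume.withDensity (fun x => ENNReal.ofReal
      (if 0 < x then (2 * π * x) ^ (-(1 : ℝ) / 2) * Real.exp (-(x + θ ^ 2) / 2) *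
          Real.cosh (θ * Real.sqrt x) else 0)) := by
  rw [gaussianReal_of_var_ne_zero θ one_ne_zero, map_sq_withDensity (measurable_gaussianPDF θ 1)]
  congr 1
  ext1 x
  by_cases hx : 0 < x
  · rw [Set.indicator_of_mem (Set.mem_Ioi.2 hx), if_pos hx,
      ← gaussianPDFReal_sqrt_add_neg_sqrt θ hx, ENNReal.ofReal_mul (by positivity),
      ENNReal.ofReal_add (gaussianPDFReal_nonneg _ _ _) (gaussianPDFReal_nonneg _ _ _)]
    rfl
  · rw [Set.indicator_of_notMem (by simpa using hx), if_neg hx, ENNReal.ofReal_zero]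
end

section
/- Let μ be a Borel probability measure on ℝ with μ([0,∞)) = 1, let g : ℝ → ℝ≥0∞ be nondecreasing on [0,∞), and suppose ν = μ.withDensity g is also a probability measure. Then ν is larger than μ in the truncated sense: for all reals 0 ≤ d ≤ y, ν((−∞,d]) · μ((−∞,y]) ≤ μ((−∞,d]) · ν((−∞,y]). -/
open MeasureTheory

/-- The general monotone-likelihood-ratio fact underlying Lemma 1 of the paper:
if `μ` is a Borel probability measure concentrated on `[0,∞)` and `ν = μ.withDensity g`
is a probability measure for a function `g` nondecreasing on `[0,∞)`, then for all
`0 ≤ d ≤ y`, `ν((−∞,d]) μ((−∞,y]) ≤ μ((−∞,d]) ν((−∞,y])`. -/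
theorem stmt_13
    (μ : Measure ℝ) [IsProbabilityMeasure μ]
    (hμ : μ (Set.Ici 0) = 1)
    (g : ℝ → ENNReal) (hg : MonotoneOn g (Set.Ici 0))
    [IsProbabilityMeasure (μ.withDensity g)]
    (d y : ℝ) (hd : 0 ≤ d) (hdy : d ≤ y) :
    (μ.withDensity g) (Set.Iic d) * μ (Set.Iic y) ≤
      μ (Set.Iic d) * (μ.withDensity g) (Set.Iic y) := by
  have h_nonneg : ∀ᵐ x ∂μ, x ∈ Set.Ici (0 : ℝ) :=
    (mem_ae_iff_prob_eq_one measurableSet_Ici).2 hμ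
  have h_below : (μ.withDensity g) (Set.Iic d) ≤ g d * μ (Set.Iic d) := by
    rw [withDensity_apply _ measurableSet_Iic, ← setLIntegral_const]
    refine setLIntegral_mono_ae' measurableSet_Iic ?_
    filter_upwards [h_nonneg] with x hx hxd using hg hx hd hxd
  have h_above : g d * μ (Set.Ioc d y) ≤ (μ.withDensity g) (Set.Ioc d y) := by
    rw [withDensity_apply _ measurableSet_Ioc, ← setLIntegral_const]
    exact setLIntegral_mono' measurableSet_Ioc fun x hx =>
      hg hd (hd.trans hx.1.le) hx.1.le
  have h_disj : Disjoint (Set.Iic d) (Set.Ioc d y) := Set.Iic_disjoint_Ioc le_rfl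
  rw [← Set.Iic_union_Ioc_eq_Iic hdy, measure_union h_disj measurableSet_Ioc,
    measure_union h_disj measurableSet_Ioc, mul_add, mul_add]
  refine add_le_add (mul_comm _ _).le ?_
  calc (μ.withDensity g) (Set.Iic d) * μ (Set.Ioc d y)
      ≤ g d * μ (Set.Iic d) * μ (Set.Ioc d y) := by gcongr
    _ = μ (Set.Iic d) * (g d * μ (Set.Ioc d y)) := by ring
    _ ≤ μ (Set.Iic d) * (μ.withDensity g) (Set.Ioc d y) := by gcongr
end
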